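/- Let (G,X) be a flow, where G is compactly generated with generating set Γ and X is zero-dimensional. Then the following conditions are pairwise equivalent: (1) every point of X is Γ-recurrent of type I; (2) every point of X is Γ-recurrent of type II; (3) every point of X is almost periodic; (4) X is a union of minimal sets; (5) the orbit closure relation R_o is closed in X × X; (6) the orbit closure map O: x ↦ cl(Gx) is ⌐continuous⌐; (7) O is upper semicontinuous; (8) for every compact open subset U of X, the set U_G^* = {x ∈ X : cl(Gx) ⊆ U} is compact open; (9) (G,X) is locally weakly almost periodic. -/

import Mathlib

/-!
STATEMENT 8 (Main theorem). Let (G,X) be a flow with `G` compactly generated with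
generating set `Γ` and `X` zero-dimensional.  Then the nine listed conditions are
pairwise equivalent.
-/

universe u

open Pointwise MulAction

/-- Convergence of a net `p : ι → Z` to `y`. -/
def NetConv {Z : Type u} [TopologicalSpace Z] {ι : Type u} [Preorder ι]
    (p : ι → Z) (y : Z) : Prop :=
  ∀ U ∈ nhds y, ∃ i₀, ∀ i, i₀ ≤ i → p i ∈ U

/-- `HLimMem Y y` : there are a subnet of the net of sets `{Y i}` and points of the
corresponding sets converging to `y`. -/
def HLimMem {Z : Type u} [TopologicalSpace Z] {ι : Type u} [Preorder ι]
    (Y : ι → Set Z) (y : Z) : Prop :=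
  ∃ (κ : Type u) (pk : Preorder κ),
    Nonempty κ ∧ IsDirected κ pk.le ∧
    ∃ (φ : κ → ι) (p : κ → Z),
      (∀ i, ∃ k₀, ∀ k, pk.le k₀ k → i ≤ φ k) ∧
      (∀ k, p k ∈ Y (φ k)) ∧
      (∀ U ∈ nhds y, ∃ k₀, ∀ k, pk.le k₀ k → p k ∈ U)

/-- `HLim Y K` : `Y_i ⇀ K`. -/
def HLim {Z : Type u} [TopologicalSpace Z] {ι : Type u} [Preorder ι]
    (Y : ι → Set Z) (K : Set Z) : Prop :=
  K = {y | HLimMem Y y}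

/-- The `Γ`-length of `g` : the least `r ≥ 1` with `g ∈ Γ^r`. -/
noncomputable def gamLen {G : Type u} [Group G] (Γ : Set G) (g : G) : ℕ :=
  sInf {r : ℕ | 0 < r ∧ g ∈ Γ ^ r}

/-- `K(g) = Γ^{|g|-1} · g`. -/
noncomputable def KSet {G : Type u} [Group G] (Γ : Set G) (g : G) : Set G :=
  Γ ^ (gamLen Γ g - 1) * {g}

/-- `Γ` is a generating set of `G`. -/
def IsGenSet {G : Type u} [Group G] [TopologicalSpace G] (Γ : Set G) : Prop :=
  IsCompact Γ ∧ (1 : G) ∈ Γ ∧ Γ⁻¹ = Γ ∧ ∀ g : G, ∃ r : ℕ, 1 ≤ r ∧ g ∈ Γ ^ r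

/-- `C` is a `Γ`-cone. -/
def IsCone {G : Type u} [Group G] [TopologicalSpace G] (Γ : Set G) (C : Set G) : Prop :=
  ∃ (ι : Type u) (pi : Preorder ι), Nonempty ι ∧ IsDirected ι pi.le ∧
    ∃ g : ι → G,
      (∀ i j, pi.le i j → gamLen Γ (g i) ≤ gamLen Γ (g j)) ∧
      (∀ n : ℕ, ∃ i₀, ∀ i, pi.le i₀ i → n ≤ gamLen Γ (g i)) ∧
      C = {t | @HLimMem G _ ι pi (fun i => KSet Γ (g i)) t}

/-- `x` is `Γ`-recurrent of type I. -/
def RecI {G X : Type u} [Group G] [TopologicalSpace G] [TopologicalSpace X] [MulAction G X]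
    (Γ : Set G) (x : X) : Prop :=
  ∀ C : Set G, IsCone Γ C → ∀ U ∈ nhds x, ∃ c ∈ C, c • x ∈ U

/-- `x` is `Γ`-recurrent of type II. -/
def RecII {G X : Type u} [Group G] [TopologicalSpace X] [MulAction G X]
    (Γ : Set G) (x : X) : Prop :=
  ∀ U ∈ nhds x, ∀ (ι : Type u) [Preorder ι] [Nonempty ι] [IsDirected ι (· ≤ ·)],
    ∀ g : ι → G, (∀ n : ℕ, ∃ i₀, ∀ i, i₀ ≤ i → n ≤ gamLen Γ (g i)) →
      ∃ n : ℕ, 1 ≤ n ∧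
        ∃ (κ : Type u) (pk : Preorder κ), Nonempty κ ∧ IsDirected κ pk.le ∧
          ∃ (φ : κ → ι) (c : κ → G),
            (∀ i, ∃ k₀, ∀ k, pk.le k₀ k → i ≤ φ k) ∧
            (∀ k, c k ∈ KSet Γ (g (φ k)) ∧ c k • x ∈ U ∧ gamLen Γ (c k) ≤ n)

/-- `A` is syndetic in `G` : `G = KA` for some compact `K ⊆ G`. -/
def Syndetic {G : Type u} [Group G] [TopologicalSpace G] (A : Set G) : Prop :=
  ∃ K : Set G, IsCompact K ∧ K * A = Set.univ

/-- `x` is an almost periodic point. -/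
def IsAPpt (G : Type u) {X : Type u} [Group G] [TopologicalSpace G] [TopologicalSpace X]
    [MulAction G X] (x : X) : Prop :=
  ∀ U ∈ nhds x, Syndetic {t : G | t • x ∈ U}

/-- `K` is a minimal set : `cl(Gx) = K` for every `x ∈ K`. -/
def IsMinimalSet (G : Type u) {X : Type u} [Group G] [TopologicalSpace X] [MulAction G X]
    (K : Set X) : Prop :=
  ∀ x ∈ K, closure (orbit G x) = K

/-- The orbit closure map is ⌐continuous⌐. -/
def OrbitMapHCont (G X : Type u) [Group G] [TopologicalSpace X] [MulAction G X] : Prop :=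
  ∀ (ι : Type u) [Preorder ι] [Nonempty ι] [IsDirected ι (· ≤ ·)],
    ∀ (x : ι → X) (x₀ : X) (K : Set X),
      NetConv x x₀ → HLim (fun i => closure (orbit G (x i))) K →
      closure (orbit G x₀) = K

/-- The orbit closure map is upper semicontinuous. -/
def OrbitMapUSC (G X : Type u) [Group G] [TopologicalSpace X] [MulAction G X] : Prop :=
  ∀ (x : X) (V : Set X), IsOpen V → closure (orbit G x) ⊆ V →
    ∃ U ∈ nhds x, ∀ y ∈ U, closure (orbit G y) ⊆ V

/-- (G,X) is locally weakly almost periodic : for every entourage `α` and every `x` there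
are a finite `F ⊆ G` and a neighborhood `U` of `x` with `Fty ∩ α[y] ≠ ∅` for all `y ∈ U`
and all `t ∈ G`. -/
def LocallyWeaklyAP (G X : Type u) [Group G] [UniformSpace X] [MulAction G X] : Prop :=
  ∀ α ∈ uniformity X, ∀ x : X, ∃ F : Set G, F.Finite ∧
    ∃ U ∈ nhds x, ∀ y ∈ U, ∀ t : G, ∃ f ∈ F, (y, (f * t) • y) ∈ α

theorem hLimMem_iff {Z ι : Type u} [TopologicalSpace Z] [Preorder ι] [Nonempty ι]
    [IsDirected ι (· ≤ ·)] {Y : ι → Set Z} {y : Z} :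
    HLimMem Y y ↔ ∀ U ∈ nhds y, ∀ i, ∃ j, i ≤ j ∧ (Y j ∩ U).Nonempty := by
  constructor
  · rintro ⟨κ, pk, hne, hdir, φ, p, hφ, hp, hlim⟩ U hU i
    obtain ⟨k₁, hk₁⟩ := hφ i
    obtain ⟨k₂, hk₂⟩ := hlim U hU
    obtain ⟨k, h₁, h₂⟩ := hdir.directed k₁ k₂
    exact ⟨φ k, hk₁ k h₁, p k, hp k, hk₂ k h₂⟩
  · intro h
    let κ := {q : ι × Set Z // q.2 ∈ nhds y ∧ (Y q.1 ∩ q.2).Nonempty}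
    let pk : Preorder κ := Preorder.lift fun k : κ => (k.1.1, OrderDual.toDual k.1.2)
    have key : ∀ i, ∀ U ∈ nhds y, ∃ k : κ, i ≤ k.1.1 ∧ k.1.2 = U := by
      intro i U hU
      obtain ⟨j, hij, hj⟩ := h U hU i
      exact ⟨⟨(j, U), hU, hj⟩, hij, rfl⟩
    choose p hp using fun k : κ => k.2.2
    refine ⟨κ, pk, ?_, ⟨fun a b => ?_⟩, fun k => k.1.1, p, fun i => ?_, fun k => (hp k).1,
      fun U hU => ?_⟩
    · obtain ⟨k, -⟩ := key (Classical.arbitrary ι) Set.univ Filter.univ_mem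
      exact ⟨k⟩
    · obtain ⟨i, hai, hbi⟩ := exists_ge_ge a.1.1 b.1.1
      obtain ⟨k, hk, hkU⟩ := key i _ (Filter.inter_mem a.2.1 b.2.1)
      exact ⟨k, ⟨hai.trans hk, hkU.trans_subset Set.inter_subset_left⟩,
        ⟨hbi.trans hk, hkU.trans_subset Set.inter_subset_right⟩⟩
    · obtain ⟨k, hk, -⟩ := key i Set.univ Filter.univ_mem
      exact ⟨k, fun k' hk' => hk.trans hk'.1⟩
    · obtain ⟨k, -, hk⟩ := key (Classical.arbitrary ι) U hU
      exact ⟨k, fun k' hk' => hk ▸ hk'.2 (hp k').2⟩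

section Length

variable {G : Type u} [Group G] {Γ : Set G}

theorem gamLen_le {g : G} {r : ℕ} (hr : 0 < r) (hg : g ∈ Γ ^ r) : gamLen Γ g ≤ r :=
  Nat.sInf_le ⟨hr, hg⟩

variable [TopologicalSpace G]

theorem IsGenSet.gamLen_spec (hΓ : IsGenSet Γ) (g : G) :
    0 < gamLen Γ g ∧ g ∈ Γ ^ gamLen Γ g := by
  obtain ⟨r, hr, hg⟩ := hΓ.2.2.2 g
  exact Nat.sInf_mem (s := {r : ℕ | 0 < r ∧ g ∈ Γ ^ r}) ⟨r, hr, hg⟩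

theorem IsGenSet.inv_mem_pow_iff (hΓ : IsGenSet Γ) {g : G} {r : ℕ} :
    g⁻¹ ∈ Γ ^ r ↔ g ∈ Γ ^ r := by
  rw [← Set.mem_inv, ← inv_pow, hΓ.2.2.1]

theorem IsGenSet.gamLen_inv (hΓ : IsGenSet Γ) (g : G) : gamLen Γ g⁻¹ = gamLen Γ g := by
  simp only [gamLen, hΓ.inv_mem_pow_iff]

theorem IsGenSet.isCompact_pow [ContinuousMul G] (hΓ : IsGenSet Γ) (n : ℕ) :
    IsCompact (Γ ^ n) := by
  induction n with
  | zero => simp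
  | succ n ih => rw [pow_succ]; exact ih.mul hΓ.1

/-- A finite set lies in some power of the generating set. -/
theorem IsGenSet.exists_finite_subset_pow (hΓ : IsGenSet Γ) {F : Set G} (hF : F.Finite) :
    ∃ n : ℕ, F ⊆ Γ ^ n := by
  obtain ⟨n, hn⟩ := (hF.image (gamLen Γ)).bddAbove
  exact ⟨n, fun f hf =>
    Set.pow_subset_pow_right hΓ.2.1 (hn ⟨f, hf, rfl⟩) (hΓ.gamLen_spec f).2⟩

/-- If `g` is long, then `K(g)` contains a right translate of `Γ ^ n` by a short element. -/
theorem IsGenSet.exists_translate_subset_kSet (hΓ : IsGenSet Γ) {g : G} {n : ℕ}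
    (hg : n + 1 ≤ gamLen Γ g) : ∃ h ∈ Γ ^ (n + 1), Γ ^ n * {h} ⊆ KSet Γ g := by
  obtain ⟨m, hm⟩ := Nat.exists_eq_add_of_le' hg
  have hmem := (hΓ.gamLen_spec g).2
  rw [hm, pow_add] at hmem
  obtain ⟨w, hw, h, hh, rfl⟩ := hmem
  refine ⟨h, hh, ?_⟩
  rintro _ ⟨a, ha, b, rfl, rfl⟩
  refine ⟨a * w⁻¹, ?_, w * b, rfl, by simp [mul_assoc]⟩
  have : gamLen Γ (w * b) - 1 = n + m := by
    have : gamLen Γ (w * b) = m + (n + 1) := hm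
    omega
  rw [this, pow_add]
  exact Set.mul_mem_mul ha (hΓ.inv_mem_pow_iff.2 hw)

end Length

section Orbit

variable {G X : Type u} [Group G] [TopologicalSpace X] [MulAction G X]

theorem smul_mem_closure_orbit (g : G) (x : X) : g • x ∈ closure (orbit G x) :=
  subset_closure (mem_orbit x g)

theorem closure_orbit_subset_iff {x : X} {U : Set X} (hU : IsClosed U) :
    closure (orbit G x) ⊆ U ↔ ∀ g : G, g • x ∈ U :=
  ⟨fun h g => h (smul_mem_closure_orbit g x),
    fun h => closure_minimal (Set.range_subset_iff.2 h) hU⟩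

theorem closure_orbit_subset [ContinuousConstSMul G X] {x y : X}
    (hy : y ∈ closure (orbit G x)) : closure (orbit G y) ⊆ closure (orbit G x) := by
  refine (closure_orbit_subset_iff isClosed_closure).2 fun g => ?_
  refine map_mem_closure (continuous_const_smul g) hy ?_
  rintro _ ⟨h, rfl⟩
  exact ⟨g * h, mul_smul g h x⟩

theorem exists_isMinimalSet_iff [ContinuousConstSMul G X] {x : X} :
    (∃ K : Set X, x ∈ K ∧ IsMinimalSet G K) ↔
      ∀ y ∈ closure (orbit G x), x ∈ closure (orbit G y) := by
  constructor
  · rintro ⟨K, hxK, hK⟩ y hy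
    rw [hK x hxK] at hy
    rwa [hK y hy]
  · intro h
    refine ⟨closure (orbit G x), subset_closure (mem_orbit_self x), fun y hy => ?_⟩
    exact (closure_orbit_subset hy).antisymm (closure_orbit_subset (h y hy))

/-- In a compact minimal orbit closure, finitely many translations suffice to bring any point
into a given open set around the base point. -/
theorem exists_finite_return [ContinuousConstSMul G X] {x : X}
    (hc : IsCompact (closure (orbit G x)))
    (hx : ∀ y ∈ closure (orbit G x), x ∈ closure (orbit G y)) {U : Set X} (hU : IsOpen U)
    (hxU : x ∈ U) :
    ∃ F : Finset G, closure (orbit G x) ⊆ ⋃ f ∈ F, (fun y : X => f • y) ⁻¹' U := by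
  refine hc.elim_finite_subcover _ (fun g => hU.preimage (continuous_const_smul g)) ?_
  intro y hy
  obtain ⟨_, hzU, g, rfl⟩ := mem_closure_iff.1 (hx y hy) U hU hxU
  exact Set.mem_iUnion.2 ⟨g, hzU⟩

end Orbit

section Flow

variable {G X : Type u} [Group G] [TopologicalSpace G] [TopologicalSpace X] [MulAction G X]

/-- A point with compact minimal orbit closure returns to each neighborhood along `F * A` with
`F` finite. -/
theorem IsAPpt.of_minimal [ContinuousConstSMul G X] {x : X}
    (hc : IsCompact (closure (orbit G x)))
    (hx : ∀ y ∈ closure (orbit G x), x ∈ closure (orbit G y)) : IsAPpt G x := by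
  intro U hU
  obtain ⟨F, hF⟩ := exists_finite_return hc hx isOpen_interior (mem_interior_iff_mem_nhds.2 hU)
  refine ⟨(F : Set G)⁻¹, (F.finite_toSet.inv).isCompact, Set.eq_univ_of_forall fun t => ?_⟩
  obtain ⟨f, hf, hft⟩ := Set.mem_iUnion₂.1 (hF (smul_mem_closure_orbit t x))
  refine ⟨f⁻¹, Set.inv_mem_inv.2 hf, f * t, ?_, inv_mul_cancel_left f t⟩
  simpa [mul_smul] using interior_subset hft

theorem IsAPpt.minimal [T2Space X] [LocallyCompactSpace X] [ContinuousSMul G X] {x : X}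
    (hx : IsAPpt G x) :
    ∀ y ∈ closure (orbit G x), x ∈ closure (orbit G y) := by
  intro y hy
  rw [mem_closure_iff_nhds]
  intro V hV
  obtain ⟨W, hW, hWV, hWc⟩ := local_compact_nhds hV
  obtain ⟨K, hK, hKA⟩ := hx W hW
  have hsub : closure (orbit G x) ⊆ K • W := by
    refine (closure_orbit_subset_iff (hK.smul_set hWc).isClosed).2 fun g => ?_
    obtain ⟨k, hk, a, ha, rfl⟩ := hKA.symm.subset (Set.mem_univ g)
    exact ⟨k, hk, a • x, ha, (mul_smul k a x).symm⟩
  obtain ⟨k, hk, w, hw, rfl⟩ := hsub hy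
  exact ⟨w, hWV hw, k⁻¹, inv_smul_smul k w⟩

theorem RecII.of_minimal [ContinuousConstSMul G X] {Γ : Set G} (hΓ : IsGenSet Γ) {x : X}
    (hc : IsCompact (closure (orbit G x)))
    (hx : ∀ y ∈ closure (orbit G x), x ∈ closure (orbit G y)) : RecII Γ x := by
  intro U hU ι _ _ _ g hg
  obtain ⟨F, hF⟩ := exists_finite_return hc hx isOpen_interior (mem_interior_iff_mem_nhds.2 hU)
  obtain ⟨n, hn⟩ := hΓ.exists_finite_subset_pow F.finite_toSet
  obtain ⟨i₀, hi₀⟩ := hg (n + 1)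
  have key : ∀ i : Set.Ici i₀, ∃ c ∈ KSet Γ (g i), c • x ∈ U ∧ gamLen Γ c ≤ n + (n + 1) := by
    rintro ⟨i, hi⟩
    obtain ⟨h, hh, hsub⟩ := hΓ.exists_translate_subset_kSet (hi₀ i hi)
    obtain ⟨f, hf, hfh⟩ := Set.mem_iUnion₂.1 (hF (smul_mem_closure_orbit h x))
    refine ⟨f * h, hsub (Set.mul_mem_mul (hn hf) rfl), ?_, gamLen_le (by omega) ?_⟩
    · rw [mul_smul]
      exact interior_subset hfh
    · rw [pow_add]
      exact Set.mul_mem_mul (hn hf) hh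
  choose c hcK hcU hcn using key
  refine ⟨n + (n + 1), by omega, Set.Ici i₀, inferInstance, ⟨⟨i₀, le_rfl⟩⟩, ⟨fun a b => ?_⟩,
    Subtype.val, c, fun i => ?_, fun k => ⟨hcK k, hcU k, hcn k⟩⟩
  · obtain ⟨d, had, hbd⟩ := exists_ge_ge a.1 b.1
    exact ⟨⟨d, a.2.trans had⟩, had, hbd⟩
  · obtain ⟨d, had, hbd⟩ := exists_ge_ge i₀ i
    exact ⟨⟨d, had⟩, fun k hk => hbd.trans hk⟩

theorem RecII.recI [ContinuousMul G] [T2Space X] [LocallyCompactSpace X]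
    [ContinuousSMul G X] {Γ : Set G} (hΓ : IsGenSet Γ) {x : X} (hx : RecII Γ x) :
    RecI Γ x := by
  rintro C ⟨ι, pι, hne, hdir, g, -, hg, rfl⟩ U hU
  obtain ⟨W, hW, hWU, hWc⟩ := local_compact_nhds hU
  obtain ⟨n, hn, κ, pk, hκne, hκdir, φ, c, hφ, hc⟩ := hx W hW ι g hg
  have hS : IsCompact (Γ ^ n ∩ (fun t : G => t • x) ⁻¹' W) :=
    (hΓ.isCompact_pow n).inter_right (hWc.isClosed.preimage (by fun_prop))
  obtain ⟨t, ht, htc⟩ := hS (f := Filter.map c Filter.atTop) (by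
    rw [Filter.le_principal_iff]
    exact Filter.eventually_map.2 <| .of_forall fun k => ⟨Set.pow_subset_pow_right hΓ.2.1 (hc k).2.2
      (hΓ.gamLen_spec (c k)).2, (hc k).2.1⟩)
  refine ⟨t, Set.mem_ofPred.2 <| hLimMem_iff.2 fun V hV i => ?_, hWU ht.2⟩
  obtain ⟨k₀, hk₀⟩ := hφ i
  obtain ⟨k, hk, hkV⟩ := Filter.frequently_atTop.1 (mapClusterPt_iff_frequently.1 htc V hV) k₀
  exact ⟨φ k, hk₀ k hk, c k, (hc k).1, hkV⟩

/-- If all points are recurrent of type I, then points near an orbit contained in a compact open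
set `U` have their whole orbit in `U`. -/
theorem isOpen_invariant_of_recI [ContinuousMul G] [T2Space X] [ContinuousSMul G X]
    {Γ : Set G} (hΓ : IsGenSet Γ) (hrec : ∀ x : X, RecI Γ x) {U : Set X} (hUc : IsCompact U)
    (hUo : IsOpen U) : IsOpen {x : X | ∀ g : G, g • x ∈ U} := by
  by_contra hnot
  obtain ⟨x, hx, hxn⟩ : ∃ x : X, (∀ g : G, g • x ∈ U) ∧
      ∀ N ∈ nhds x, ∃ y ∈ N, ∃ g : G, g • y ∉ U := by
    rw [isOpen_iff_mem_nhds] at hnot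
    push Not at hnot
    obtain ⟨x, hx, hxn⟩ := hnot
    refine ⟨x, hx, fun N hN => ?_⟩
    by_contra! h
    exact hxn (Filter.mem_of_superset hN h)
  have escape : ∀ n : ℕ, ∃ z ∈ (Γ • U) \ U, ∃ h : G, n ≤ gamLen Γ h ∧
      ∀ c ∈ KSet Γ h, c • z ∈ U := by
    intro n
    obtain ⟨A, N, -, hN, hA, hxN, hAN⟩ := generalized_tube_lemma (hΓ.isCompact_pow n)
      (isCompact_singleton (x := x)) (hUo.preimage (continuous_smul (M := G) (X := X)))
      (fun p hp => by
        have : p.2 = x := hp.2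
        simpa [this] using hx p.1)
    have hN' : N ∈ nhds x := hN.mem_nhds (hxN rfl)
    obtain ⟨y, hyN, g₀, hg₀⟩ := hxn N hN'
    have hyU : ∀ c ∈ Γ ^ n, c • y ∈ U := fun c hc => hAN (Set.mk_mem_prod (hA hc) hyN)
    obtain ⟨g, hg, hmin⟩ : ∃ g : G, g • y ∉ U ∧ ∀ g' : G, g' • y ∉ U →
        gamLen Γ g ≤ gamLen Γ g' := by
      obtain ⟨g, hg, hmin⟩ := exists_minimalFor_of_wellFoundedLT (fun g : G => g • y ∉ U)
        (gamLen Γ) ⟨g₀, hg₀⟩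
      exact ⟨g, hg, fun g' hg' => (le_total _ _).elim id (hmin hg')⟩
    have hlow : ∀ c ∈ Γ ^ (gamLen Γ g - 1), c • y ∈ U := by
      intro c hc
      rcases Nat.eq_zero_or_pos (gamLen Γ g - 1) with h0 | hpos
      · rw [h0, pow_zero] at hc
        obtain rfl : c = 1 := hc
        exact hyU 1 (Set.one_mem_pow hΓ.2.1)
      · by_contra hcU
        have h₁ := hmin c hcU
        have h₂ := gamLen_le hpos hc
        omega
    obtain ⟨hpos, hgm⟩ := hΓ.gamLen_spec g
    refine ⟨g • y, ⟨?_, hg⟩, g⁻¹, ?_, ?_⟩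
    · rw [← Nat.sub_add_cancel hpos, pow_succ'] at hgm
      obtain ⟨γ, hγ, c, hc, rfl⟩ := hgm
      exact ⟨γ, hγ, c • y, hlow c hc, (mul_smul γ c y).symm⟩
    · rw [hΓ.gamLen_inv]
      by_contra! hlt
      exact hg (hyU g (Set.pow_subset_pow_right hΓ.2.1 hlt.le hgm))
    · rw [KSet, hΓ.gamLen_inv]
      rintro _ ⟨c, hc, b, rfl, rfl⟩
      simpa [mul_smul] using hlow c hc
  choose z hz h hlen hK using escape
  obtain ⟨y, hy, hyc⟩ := (hΓ.1.smul_set hUc).diff hUo (f := Filter.map z Filter.atTop)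
    (Filter.le_principal_iff.2 (Filter.eventually_map.2 (.of_forall hz)))
  have hfreq := mapClusterPt_iff_frequently.1 hyc
  let ι := {q : G × Set X // q.2 ∈ nhds y ∧ ∃ w ∈ q.2, ∀ c ∈ KSet Γ q.1, c • w ∈ U}
  let pι : Preorder ι :=
    Preorder.lift fun i : ι => (gamLen Γ i.1.1, OrderDual.toDual i.1.2)
  have key : ∀ n : ℕ, ∀ V ∈ nhds y, ∃ i : ι, n ≤ gamLen Γ i.1.1 ∧ i.1.2 = V := by
    intro n V hV
    obtain ⟨m, hm, hmV⟩ := Filter.frequently_atTop.1 (hfreq V hV) n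
    exact ⟨⟨(h m, V), hV, z m, hmV, hK m⟩, hm.trans (hlen m), rfl⟩
  have hne : Nonempty ι := (key 0 Set.univ Filter.univ_mem).nonempty
  have hdir : IsDirected ι (· ≤ ·) := by
    refine ⟨fun a b => ?_⟩
    obtain ⟨i, hi, hiV⟩ := key (max (gamLen Γ a.1.1) (gamLen Γ b.1.1)) _
      (Filter.inter_mem a.2.1 b.2.1)
    exact ⟨i, ⟨(le_max_left _ _).trans hi, hiV.trans_subset Set.inter_subset_left⟩,
      ⟨(le_max_right _ _).trans hi, hiV.trans_subset Set.inter_subset_right⟩⟩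
  have hcone : IsCone Γ {t : G | HLimMem (fun i : ι => KSet Γ i.1.1) t} := by
    refine ⟨ι, pι, hne, hdir, fun i => i.1.1, fun i j hij => hij.1, fun n => ?_, rfl⟩
    obtain ⟨i, hi, -⟩ := key n Set.univ Filter.univ_mem
    exact ⟨i, fun j hj => hi.trans hj.1⟩
  obtain ⟨t, ht, hty⟩ := hrec y _ hcone Uᶜ (hUc.isClosed.isOpen_compl.mem_nhds hy.2)
  have hnhds : (fun p : G × X => p.1 • p.2) ⁻¹' Uᶜ ∈ nhds (t, y) :=
    (hUc.isClosed.isOpen_compl.preimage continuous_smul).mem_nhds hty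
  obtain ⟨A, hA, B, hB, hAB⟩ := mem_nhds_prod_iff.1 hnhds
  obtain ⟨i, -, hi⟩ := key 0 B hB
  obtain ⟨j, hij, c, hcK, hcA⟩ := hLimMem_iff.1 (Set.mem_ofPred.1 ht) A hA i
  obtain ⟨-, w, hw, hwU⟩ := j.2
  exact hAB (Set.mk_mem_prod hcA (hi ▸ hij.2 hw)) (hwU c hcK)

end Flow

section OrbitMap

variable {G X : Type u} [Group G] [TopologicalSpace X] [MulAction G X]

theorem OrbitMapUSC.isClosed_rel [T2Space X] [LocallyCompactSpace X] (h : OrbitMapUSC G X) :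
    IsClosed {p : X × X | p.2 ∈ closure (orbit G p.1)} := by
  rw [← isOpen_compl_iff, isOpen_iff_mem_nhds]
  rintro ⟨x, y⟩ hxy
  obtain ⟨W, hW, hWsub, hWc⟩ :=
    local_compact_nhds (isClosed_closure.isOpen_compl.mem_nhds hxy)
  obtain ⟨U, hU, hUsub⟩ := h x Wᶜ hWc.isClosed.isOpen_compl fun z hz hzW => hWsub hzW hz
  filter_upwards [prod_mem_nhds hU hW] with p hp hmem
  exact hUsub p.1 hp.1 hmem hp.2

theorem mem_closure_orbit_symm_of_isClosed_rel
    (h : IsClosed {p : X × X | p.2 ∈ closure (orbit G p.1)}) (x : X) :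
    ∀ y ∈ closure (orbit G x), x ∈ closure (orbit G y) := by
  have hcl : IsClosed {y : X | x ∈ closure (orbit G y)} :=
    h.preimage (f := fun y : X => (y, x)) (by fun_prop)
  exact (closure_orbit_subset_iff hcl).2 fun g =>
    subset_closure ⟨g⁻¹, inv_smul_smul g x⟩

theorem OrbitMapHCont.of_isClosed_rel [ContinuousConstSMul G X]
    (h : IsClosed {p : X × X | p.2 ∈ closure (orbit G p.1)}) : OrbitMapHCont G X := by
  rintro ι _ _ _ x x₀ _ hx rfl
  ext z
  rw [Set.mem_ofPred_eq, hLimMem_iff]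
  constructor
  · intro hz V hV i
    obtain ⟨_, hgV, g, rfl⟩ := mem_closure_iff_nhds.1 hz _ (interior_mem_nhds.2 hV)
    obtain ⟨i₀, hi₀⟩ := hx _ ((isOpen_interior.preimage (continuous_const_smul g)).mem_nhds hgV)
    obtain ⟨j, hj, hij⟩ := exists_ge_ge i₀ i
    exact ⟨j, hij, g • x j, smul_mem_closure_orbit g (x j), interior_subset (hi₀ j hj)⟩
  · intro hz
    refine h.closure_subset (a := (x₀, z)) (mem_closure_iff_nhds.2 fun N hN => ?_)
    obtain ⟨A, hA, B, hB, hAB⟩ := mem_nhds_prod_iff.1 hN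
    obtain ⟨i₀, hi₀⟩ := hx A hA
    obtain ⟨j, hj, w, hw, hwB⟩ := hz B hB i₀
    exact ⟨(x j, w), hAB (Set.mk_mem_prod (hi₀ j hj) hwB), hw⟩

theorem OrbitMapHCont.isClosed_rel (h : OrbitMapHCont G X) :
    IsClosed {p : X × X | p.2 ∈ closure (orbit G p.1)} := by
  refine isClosed_of_closure_subset fun p hp => ?_
  let R : Set (X × X) := {p | p.2 ∈ closure (orbit G p.1)}
  let ι := {q : Set (X × X) × (X × X) // q.1 ∈ nhds p ∧ q.2 ∈ q.1 ∩ R}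
  let pι : Preorder ι :=
    Preorder.lift fun i : ι => OrderDual.toDual i.1.1
  have key : ∀ V ∈ nhds p, ∃ i : ι, i.1.1 = V := by
    intro V hV
    obtain ⟨q, hq⟩ := mem_closure_iff_nhds.1 hp V hV
    exact ⟨⟨(V, q), hV, hq⟩, rfl⟩
  have hne : Nonempty ι := (key Set.univ Filter.univ_mem).nonempty
  have hdir : IsDirected ι (· ≤ ·) := by
    refine ⟨fun a b => ?_⟩
    obtain ⟨i, hi⟩ := key _ (Filter.inter_mem a.2.1 b.2.1)
    exact ⟨i, hi.trans_subset Set.inter_subset_left, hi.trans_subset Set.inter_subset_right⟩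
  have hconv : NetConv (fun i : ι => i.1.2.1) p.1 := by
    intro U hU
    obtain ⟨i, hi⟩ := key (Prod.fst ⁻¹' U) (continuous_fst.continuousAt hU)
    exact ⟨i, fun j hj => by simpa [hi] using (show j.1.1 ⊆ i.1.1 from hj) j.2.2.1⟩
  have heq := h ι (fun i => i.1.2.1) p.1 _ hconv rfl
  refine heq.symm.subset (Set.mem_ofPred.2 <| hLimMem_iff.2 fun U hU i => ?_)
  obtain ⟨j, hj⟩ := key _ (Filter.inter_mem i.2.1 (continuous_snd.continuousAt hU))
  have hjm : j.1.2 ∈ i.1.1 ∩ Prod.snd ⁻¹' U := hj ▸ j.2.2.1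
  exact ⟨j, hj.trans_subset Set.inter_subset_left, j.1.2.2, j.2.2.2, hjm.2⟩

/-- In a locally compact Hausdorff space with a clopen base, compact sets have a basis of
compact open neighborhoods. -/
theorem exists_isCompact_isOpen_between [T2Space X] [LocallyCompactSpace X]
    (hzero : TopologicalSpace.IsTopologicalBasis {s : Set X | IsClopen s}) {K V : Set X}
    (hK : IsCompact K) (hV : IsOpen V) (hKV : K ⊆ V) :
    ∃ U : Set X, IsCompact U ∧ IsOpen U ∧ K ⊆ U ∧ U ⊆ V := by
  obtain ⟨L, hL, hKL, hLV⟩ := exists_compact_between hK hV hKV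
  have : ∀ x : K, ∃ s : Set X, IsClopen s ∧ x.1 ∈ s ∧ s ⊆ interior L := fun x =>
    hzero.exists_subset_of_mem_open (hKL x.2) isOpen_interior
  choose s hs hxs hsL using this
  obtain ⟨t, ht⟩ := hK.elim_finite_subcover s (fun x => (hs x).isOpen) fun x hx =>
    Set.mem_iUnion.2 ⟨⟨x, hx⟩, hxs ⟨x, hx⟩⟩
  have hsub : ⋃ x ∈ t, s x ⊆ L := Set.iUnion₂_subset fun x _ => (hsL x).trans interior_subset
  exact ⟨⋃ x ∈ t, s x,
    hL.of_isClosed_subset (isClosed_biUnion_finset fun x _ => (hs x).isClosed) hsub,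
    isOpen_biUnion fun x _ => (hs x).isOpen, ht, hsub.trans hLV⟩

end OrbitMap

section Uniform

variable {G X : Type u} [Group G] [UniformSpace X] [MulAction G X]

theorem LocallyWeaklyAP.isAPpt [TopologicalSpace G] (h : LocallyWeaklyAP G X) (x : X) :
    IsAPpt G x := by
  intro U hU
  obtain ⟨α, hα, hαU⟩ := UniformSpace.mem_nhds_iff.1 hU
  obtain ⟨F, hF, N, hN, hFN⟩ := h α hα x
  refine ⟨F⁻¹, hF.inv.isCompact, Set.eq_univ_of_forall fun t => ?_⟩
  obtain ⟨f, hf, hft⟩ := hFN x (mem_of_mem_nhds hN) t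
  exact ⟨f⁻¹, Set.inv_mem_inv.2 hf, f * t, hαU hft, inv_mul_cancel_left f t⟩

theorem OrbitMapUSC.locallyWeaklyAP [ContinuousConstSMul G X]
    (horb : ∀ x : X, IsCompact (closure (orbit G x))) (h : OrbitMapUSC G X)
    (hmin : ∀ x : X, ∀ y ∈ closure (orbit G x), x ∈ closure (orbit G y)) :
    LocallyWeaklyAP G X := by
  intro α hα x
  have hα' : α ∈ nhds (x, x) := nhds_le_uniformity x hα
  obtain ⟨A, hA, B, hB, hAB⟩ := mem_nhds_prod_iff.1 hα'
  obtain ⟨F, hF⟩ := exists_finite_return (horb x) (hmin x) isOpen_interior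
    (mem_interior_iff_mem_nhds.2 hB)
  obtain ⟨U, hU, hUF⟩ := h x _ (isOpen_biUnion fun f _ =>
    isOpen_interior.preimage (continuous_const_smul f)) hF
  refine ⟨F, F.finite_toSet, U ∩ A, Filter.inter_mem hU hA, fun y hy t => ?_⟩
  obtain ⟨f, hf, hft⟩ := Set.mem_iUnion₂.1 (hUF y hy.1 (smul_mem_closure_orbit t y))
  refine ⟨f, hf, hAB (Set.mk_mem_prod hy.2 ?_)⟩
  rw [mul_smul]
  exact interior_subset hft

end Uniform

theorem stmt_8 {G X : Type u}
    [Group G] [TopologicalSpace G] [T2Space G] [ContinuousMul G]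
    [UniformSpace X] [T2Space X] [LocallyCompactSpace X]
    (hzero : TopologicalSpace.IsTopologicalBasis {s : Set X | IsClopen s})
    [MulAction G X] [ContinuousSMul G X]
    (horb : ∀ x : X, IsCompact (closure (orbit G x)))
    (Γ : Set G) (hΓ : IsGenSet Γ) :
    List.TFAE
      [∀ x : X, RecI Γ x,
       ∀ x : X, RecII Γ x,
       ∀ x : X, IsAPpt G x,
       ∀ x : X, ∃ K : Set X, x ∈ K ∧ IsMinimalSet G K,
       IsClosed {p : X × X | p.2 ∈ closure (orbit G p.1)},
       OrbitMapHCont G X,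
       OrbitMapUSC G X,
       ∀ U : Set X, IsCompact U → IsOpen U →
         IsCompact {x : X | closure (orbit G x) ⊆ U} ∧
         IsOpen {x : X | closure (orbit G x) ⊆ U},
       LocallyWeaklyAP G X] := by
  tfae_have 1 → 8 := by
    intro h U hUc hUo
    have heq : {x : X | closure (orbit G x) ⊆ U} = {x : X | ∀ g : G, g • x ∈ U} :=
      Set.ext fun x => closure_orbit_subset_iff hUc.isClosed
    have hcl : IsClosed {x : X | ∀ g : G, g • x ∈ U} := by
      simp only [Set.ofPred_forall]
      exact isClosed_iInter fun g => hUc.isClosed.preimage (continuous_const_smul g)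
    rw [heq]
    exact ⟨hUc.of_isClosed_subset hcl fun x hx => by simpa using hx 1,
      isOpen_invariant_of_recI hΓ h hUc hUo⟩
  tfae_have 8 → 7 := by
    intro h x V hV hxV
    obtain ⟨U, hUc, hUo, hxU, hUV⟩ := exists_isCompact_isOpen_between hzero (horb x) hV hxV
    exact ⟨_, (h U hUc hUo).2.mem_nhds hxU, fun y hy => Set.Subset.trans hy hUV⟩
  tfae_have 7 → 5 := OrbitMapUSC.isClosed_rel
  tfae_have 5 → 6 := OrbitMapHCont.of_isClosed_rel
  tfae_have 6 → 5 := OrbitMapHCont.isClosed_rel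
  tfae_have 5 → 4 := fun h x =>
    exists_isMinimalSet_iff.2 (mem_closure_orbit_symm_of_isClosed_rel h x)
  tfae_have 4 → 3 := fun h x => .of_minimal (horb x) (exists_isMinimalSet_iff.1 (h x))
  tfae_have 3 → 2 := fun h x => .of_minimal hΓ (horb x) (h x).minimal
  tfae_have 2 → 1 := fun h x => (h x).recI hΓ
  tfae_have 7 → 9 := fun h => h.locallyWeaklyAP horb
    (mem_closure_orbit_symm_of_isClosed_rel h.isClosed_rel)
  tfae_have 9 → 3 := LocallyWeaklyAP.isAPpt
  tfae_finish
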